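/- For every real y ∈ (0.9999999996, 1.00000000009) there exists exactly one real number t ∈ (0.6263716633 − 10⁻¹⁰, 0.6263716633 + 10⁻¹⁰) with Y(t) = y. -/

import Mathlib

noncomputable def h1 (t : ℝ) : ℝ := (2*t+1)/((3*t+1)*(1-t))

noncomputable def h2 (t : ℝ) : ℝ :=
  -(t^2*(1-t)*(5*t^2+36*t+18))/(2*(t+3)*(2*t+1)*(3*t+1)^2)

noncomputable def Y (t : ℝ) : ℝ := -1 + h1 t * Real.exp (h2 t)

noncomputable def auxN (t : ℝ) : ℝ := 18*t^2+18*t^3-31*t^4-5*t^5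
noncomputable def auxD (t : ℝ) : ℝ := 36*t^4+150*t^3+142*t^2+50*t+6

lemma h2_eq (t : ℝ) : h2 t = -(auxN t / auxD t) := by
  unfold h2 auxN auxD
  rw [neg_div]
  congr 2 <;> ring

lemma h2_mono : StrictMonoOn h2 (Set.Icc (0.626:ℝ) 0.627) := by
  have hD : ∀ t ∈ Set.Icc (0.626:ℝ) 0.627, 0 < auxD t := by
    intro t ht
    have : 0 < t := by linarith [ht.1]
    unfold auxD; positivity
  have hd : ∀ t ∈ Set.Icc (0.626:ℝ) 0.627, HasDerivAt h2
      (-(((36*t+54*t^2-124*t^3-25*t^4) * auxD t - auxN t * (144*t^3+450*t^2+284*t+50)) / (auxD t)^2)) t := by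
    intro t ht
    have e : h2 = fun t => -(auxN t / auxD t) := funext h2_eq
    rw [e]
    have p := fun n : ℕ => hasDerivAt_pow n t
    have hN' : HasDerivAt auxN (36*t+54*t^2-124*t^3-25*t^4) t := by
      have := ((((p 2).const_mul 18).add ((p 3).const_mul 18)).sub ((p 4).const_mul 31)).sub
        ((p 5).const_mul 5)
      refine HasDerivAt.congr_deriv this ?_
      norm_num; ring
    have hD' : HasDerivAt auxD (144*t^3+450*t^2+284*t+50) t := by
      have := (((((p 4).const_mul 36).add ((p 3).const_mul 150)).add ((p 2).const_mul 142)).add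
        ((hasDerivAt_id t).const_mul 50)).add_const 6
      refine HasDerivAt.congr_deriv this ?_
      norm_num; ring
    exact (hN'.div hD' (hD t ht).ne').neg
  apply strictMonoOn_of_deriv_pos (convex_Icc _ _)
  · intro t ht
    exact (hd t ht).continuousAt.continuousWithinAt
  · intro t ht
    have ht := interior_subset ht
    rw [(hd t ht).deriv]
    rw [← neg_div]
    apply div_pos _ (pow_pos (hD t ht) 2)
    obtain ⟨l, u⟩ := ht
    have l' : ∀ n : ℕ, (0.626:ℝ)^n ≤ t^n := fun n => by gcongr
    have u' : ∀ n : ℕ, t^n ≤ (0.627:ℝ)^n := fun n =>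
      pow_le_pow_left₀ (by linarith) u n
    have l2 := l' 2
    have l3 := l' 3
    have l4 := l' 4
    have u2 := u' 2
    have u3 := u' 3
    have u4 := u' 4
    have u5 := u' 5
    norm_num at l2 l3 l4 u2 u3 u4 u5
    have b1 : 36*t+54*t^2-124*t^3-25*t^4 ≤ 10 := by linarith
    have b2 : auxD t ≤ 140 := by unfold auxD; linarith
    have b3 : 6 ≤ auxN t := by unfold auxN; linarith
    have b4 : 400 ≤ 144*t^3+450*t^2+284*t+50 := by linarith
    have b5 : 0 < auxD t := hD t ⟨l, u⟩
    nlinarith [mul_le_mul_of_nonneg_right b1 b5.le,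
      mul_le_mul b3 b4 (by norm_num) (by linarith)]

lemma h1_pos {t : ℝ} (ht : t ∈ Set.Icc (0.626:ℝ) 0.627) : 0 < h1 t := by
  obtain ⟨l, u⟩ := ht
  unfold h1
  apply div_pos (by linarith) (mul_pos (by linarith) (by linarith))

lemma h1_mono : StrictMonoOn h1 (Set.Icc (0.626:ℝ) 0.627) := by
  rintro s ⟨l, u⟩ t ⟨l', u'⟩ h
  unfold h1
  rw [div_lt_div_iff₀ (mul_pos (by linarith) (by linarith)) (mul_pos (by linarith) (by linarith))]
  have : 0 < (t - s) * (6*s*t+3*(s+t) - 0) := mul_pos (by linarith) (by nlinarith)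
  nlinarith

lemma Y_mono : StrictMonoOn Y (Set.Icc (0.626:ℝ) 0.627) := by
  intro s hs t ht h
  unfold Y
  have a := h1_mono hs ht h
  have b := Real.exp_lt_exp.2 (h2_mono hs ht h)
  have := mul_lt_mul'' a b (h1_pos hs).le (Real.exp_pos _).le
  linarith

lemma Y_cont : ContinuousOn Y (Set.Icc (0.626:ℝ) 0.627) := by
  unfold Y h1 h2
  have k : ∀ t ∈ Set.Icc (0.626:ℝ) 0.627, (3*t+1)*(1-t) ≠ 0 := by
    rintro t ⟨l, u⟩
    exact (mul_pos (by linarith) (by linarith)).ne'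
  have k' : ∀ t ∈ Set.Icc (0.626:ℝ) 0.627, 2*(t+3)*(2*t+1)*(3*t+1)^2 ≠ 0 := by
    rintro t ⟨l, u⟩
    have : 0 < t := by linarith
    positivity
  refine continuousOn_const.add (ContinuousOn.mul (ContinuousOn.div (by fun_prop) (by fun_prop) k)
    (Real.continuous_exp.comp_continuousOn (ContinuousOn.div (by fun_prop) (by fun_prop) k')))

lemma Y_left : Y (0.6263716633 - 1e-10) < 0.9999999996 := by
  have a : h2 (0.6263716633 - 1e-10) ≤ -0.0460123253147 := by unfold h2; norm_num
  have b : h1 (0.6263716633 - 1e-10) ≤ 2.09417463254 := by unfold h1; norm_num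
  have c : Real.exp (-0.0460123253147) ≤ 0.95503019109 := by
    have := Real.exp_bound (x := -0.0460123253147) (by norm_num [abs_le]) (n := 8) (by norm_num)
    rw [abs_le] at this
    have := this.2
    norm_num [Finset.sum_range_succ, Nat.factorial, abs_of_pos] at this ⊢
    linarith
  have d := (Real.exp_le_exp.2 a).trans c
  have := mul_le_mul b d (Real.exp_pos _).le (by norm_num)
  unfold Y
  norm_num at this ⊢
  linarith

lemma Y_right : 1.00000000009 < Y (0.6263716633 + 1e-10) := by
  have a : -0.0460123252989 ≤ h2 (0.6263716633 + 1e-10) := by unfold h2; norm_num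
  have b : 2.09417463359 ≤ h1 (0.6263716633 + 1e-10) := by unfold h1; norm_num
  have c : 0.95503019107 ≤ Real.exp (-0.0460123252989) := by
    have := Real.exp_bound (x := -0.0460123252989) (by norm_num [abs_le]) (n := 8) (by norm_num)
    rw [abs_le] at this
    have := this.1
    norm_num [Finset.sum_range_succ, Nat.factorial, abs_of_pos] at this ⊢
    linarith
  have d := c.trans (Real.exp_le_exp.2 a)
  have := mul_le_mul b d (by norm_num) ((by norm_num : (0:ℝ) ≤ 2.09417463359).trans b)
  unfold Y
  norm_num at this ⊢
  linarith

theorem Y_inverse_exists_unique :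
    ∀ y : ℝ, y ∈ Set.Ioo (0.9999999996 : ℝ) 1.00000000009 →
      ∃! t : ℝ, t ∈ Set.Ioo (0.6263716633 - 1e-10 : ℝ) (0.6263716633 + 1e-10) ∧ Y t = y := by
  intro y hy
  have sub : Set.Icc (0.6263716633 - 1e-10 : ℝ) (0.6263716633 + 1e-10) ⊆ Set.Icc 0.626 0.627 :=
    Set.Icc_subset_Icc (by norm_num) (by norm_num)
  obtain ⟨t, ht, e⟩ := intermediate_value_Ioo (by norm_num) (Y_cont.mono sub)
    ⟨Y_left.trans hy.1, hy.2.trans Y_right⟩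
  refine ⟨t, ⟨ht, e⟩, ?_⟩
  rintro s ⟨hs, e'⟩
  exact Y_mono.injOn (sub (Set.Ioo_subset_Icc_self hs)) (sub (Set.Ioo_subset_Icc_self ht))
    (e'.trans e.symm)
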